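/- arXiv:2111.10424 — 2 statements merged into one kernel-verified Lean document; each statement's English description precedes it below -/
import Mathlib

section
/- Let (X,f) be a recurrent dynamical system with shadowing. Then for every p ∈ X, the chain accessible set Ch(p) is minimal for f: Ch(p) is nonempty, closed and f-invariant, and every nonempty closed subset A ⊆ Ch(p) with f(A) ⊆ A satisfies A = Ch(p). -/
/-- The system `(X, f)` has shadowing. -/
def HasShadowing {X : Type*} [MetricSpace X] (f : X → X) : Prop :=
  ∀ ε > (0 : ℝ), ∃ δ > (0 : ℝ), ∀ x : ℕ → X,
    (∀ i : ℕ, dist (f (x i)) (x (i + 1)) < δ) →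
      ∃ z : X, ∀ i : ℕ, dist (f^[i] z) (x i) < ε

/-- A point `x` is recurrent for `f`. -/
def IsRecurrentPt {X : Type*} [MetricSpace X] (f : X → X) (x : X) : Prop :=
  ∀ ε > (0 : ℝ), ∃ n : ℕ, 0 < n ∧ dist (f^[n] x) x < ε

/-- There is a `δ`-chain for `f` from `a` to `b`. -/
def ExistsDeltaChain {X : Type*} [MetricSpace X] (f : X → X) (δ : ℝ) (a b : X) : Prop :=
  ∃ n : ℕ, 0 < n ∧ ∃ x : ℕ → X, x 0 = a ∧ x n = b ∧
    ∀ i < n, dist (f (x i)) (x (i + 1)) < δ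

/-- The chain accessible set of `a`. -/
def ChainAcc {X : Type*} [MetricSpace X] (f : X → X) (a : X) : Set X :=
  {b : X | ∀ δ > (0 : ℝ), ExistsDeltaChain f δ a b}

/-- One step of a `δ`-chain. -/
def StepRel {X : Type*} [MetricSpace X] (f : X → X) (δ : ℝ) (a b : X) : Prop :=
  dist (f a) b < δ

theorem chain_iff {X : Type*} [MetricSpace X] (f : X → X) (δ : ℝ) (a b : X) :
    ExistsDeltaChain f δ a b ↔ Relation.TransGen (StepRel f δ) a b := by
  constructor
  · rintro ⟨n, hn, x, h0, hb, hx⟩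
    have key : ∀ k, k < n → Relation.TransGen (StepRel f δ) (x 0) (x (k + 1)) := by
      intro k
      induction k with
      | zero => intro hk; exact Relation.TransGen.single (hx 0 hk)
      | succ k ih => intro hk; exact (ih (by omega)).tail (hx (k + 1) hk)
    obtain ⟨m, rfl⟩ : ∃ m, n = m + 1 := ⟨n - 1, by omega⟩
    rw [← h0, ← hb]
    exact key m (by omega)
  · intro h
    induction h with
    | single h =>
      rename_i b
      refine ⟨1, one_pos, fun i => if i = 0 then a else b, by simp, by simp, ?_⟩
      intro i hi
      obtain rfl : i = 0 := by omega
      simpa [StepRel] using h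
    | tail _ h ih =>
      rename_i c d _
      obtain ⟨n, hn, x, h0, hb, hx⟩ := ih
      refine ⟨n + 1, by omega, fun i => if i ≤ n then x i else d, by simp [h0], by simp, ?_⟩
      intro i hi
      by_cases hin : i = n
      · subst hin
        simpa [hb, StepRel] using h
      · have h1 : i ≤ n := by omega
        have h2 : i + 1 ≤ n := by omega
        simpa [h1, h2] using hx i (by omega)

theorem recurrent_large {X : Type*} [MetricSpace X] (f : X → X) (hf : Continuous f) (z : X)
    (hz : IsRecurrentPt f z) (N : ℕ) : ∀ ε > (0 : ℝ), ∃ n, N ≤ n ∧ dist (f^[n] z) z < ε := by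
  induction N with
  | zero =>
    intro ε hε
    exact ⟨0, le_rfl, by simpa using hε⟩
  | succ N ih =>
    intro ε hε
    obtain ⟨n, hn, hd⟩ := ih (ε / 2) (by linarith)
    obtain ⟨δ, hδ, hc⟩ := Metric.continuous_iff.1 (hf.iterate n) z (ε / 2) (by linarith)
    obtain ⟨m, hm, hmd⟩ := hz δ hδ
    refine ⟨n + m, by omega, ?_⟩
    rw [Function.iterate_add_apply]
    have := hc _ hmd
    linarith [dist_triangle (f^[n] (f^[m] z)) (f^[n] z) z]

theorem orbit_chain {X : Type*} [MetricSpace X] (f : X → X) (δ : ℝ) (hδ : 0 < δ) (x : X) (k : ℕ) :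
    Relation.ReflTransGen (StepRel f δ) x (f^[k] x) := by
  induction k with
  | zero => exact Relation.ReflTransGen.refl
  | succ k ih =>
    refine ih.tail ?_
    rw [Function.iterate_succ_apply']
    simpa [StepRel] using hδ

theorem chain_reverse {X : Type*} [MetricSpace X] [CompactSpace X] (f : X → X) (hf : Continuous f)
    (hrec : ∀ x : X, IsRecurrentPt f x) (δ : ℝ) (hδ : 0 < δ) :
    ∃ δ' > (0 : ℝ), ∀ x y, Relation.TransGen (StepRel f δ') x y →
      Relation.TransGen (StepRel f δ) y x := by
  obtain ⟨δ', hδ', hu⟩ := Metric.uniformContinuous_iff.1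
    (CompactSpace.uniformContinuous_of_continuous hf) δ hδ
  have step : ∀ x y, StepRel f δ' x y → Relation.TransGen (StepRel f δ) y x := by
    intro x y h
    obtain ⟨n, hn, hd⟩ := recurrent_large f hf x (hrec x) 3 δ hδ
    obtain ⟨k, rfl⟩ : ∃ k, n = k + 3 := ⟨n - 3, by omega⟩
    have h1 : StepRel f δ y (f (f x)) := by
      have := hu h
      rwa [dist_comm] at this
    have h2 := orbit_chain f δ hδ (f (f x)) k
    have h3 : StepRel f δ (f^[k] (f (f x))) x := by
      unfold StepRel
      rw [← Function.iterate_succ_apply' f k, ← Function.iterate_succ_apply,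
        ← Function.iterate_succ_apply]
      exact hd
    exact (Relation.TransGen.head' h1 h2).tail h3
  refine ⟨δ', hδ', fun x y h => ?_⟩
  induction h with
  | single h => exact step _ _ h
  | tail _ h ih => exact (step _ _ h).trans ih

/-- In a recurrent system with shadowing, for every `p` the chain accessible set `Ch(p)` is
a minimal set for `f`. -/
theorem recurrent_shadowing_chainAcc_minimal
    {X : Type*} [MetricSpace X] [CompactSpace X]
    (f : X → X) (hf : Continuous f)
    (hrec : ∀ x : X, IsRecurrentPt f x)
    (hsh : HasShadowing f) :
    ∀ p : X, (ChainAcc f p).Nonempty ∧ IsClosed (ChainAcc f p) ∧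
      f '' ChainAcc f p ⊆ ChainAcc f p ∧
      ∀ A : Set X, A ⊆ ChainAcc f p → A.Nonempty → IsClosed A → f '' A ⊆ A →
        A = ChainAcc f p := by
  intro p
  have hmem : ∀ q b, b ∈ ChainAcc f q ↔ ∀ δ > (0 : ℝ), Relation.TransGen (StepRel f δ) q b :=
    fun q b => forall₂_congr fun δ _ => chain_iff f δ q b
  have hself : ∀ δ > (0 : ℝ), ∀ x, StepRel f δ x (f x) := by
    intro δ hδ x
    simpa [StepRel] using hδ
  refine ⟨⟨f p, (hmem _ _).2 fun δ hδ => .single (hself δ hδ p)⟩, ?_, ?_, ?_⟩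
  · refine isClosed_of_closure_subset fun b hb => (hmem _ _).2 fun δ hδ => ?_
    obtain ⟨b', hb', hd⟩ := Metric.mem_closure_iff.1 hb (δ / 2) (by linarith)
    have h := (hmem _ _).1 hb' (δ / 2) (by linarith)
    obtain ⟨c, hc, hcb⟩ := Relation.TransGen.tail'_iff.1 h
    refine Relation.TransGen.tail' (Relation.ReflTransGen.mono (fun x y hxy => ?_) _ _ hc) (?_ : StepRel f δ c b)
    · unfold StepRel at *
      linarith
    · unfold StepRel at *
      rw [dist_comm] at hd
      linarith [dist_triangle (f c) b' b]
  · rintro _ ⟨b, hb, rfl⟩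
    exact (hmem _ _).2 fun δ hδ => ((hmem _ _).1 hb δ hδ).tail (hself δ hδ b)
  · intro A hA ⟨a, ha⟩ hcl hinv
    refine Set.Subset.antisymm hA fun b hb => ?_
    have horb : ∀ k, f^[k] a ∈ A := by
      intro k
      induction k with
      | zero => exact ha
      | succ k ih =>
        rw [Function.iterate_succ_apply']
        exact hinv ⟨_, ih, rfl⟩
    rw [← hcl.closure_eq, Metric.mem_closure_iff]
    intro ε hε
    obtain ⟨δ, hδ, hs⟩ := hsh (ε / 3) (by linarith)
    obtain ⟨δ', hδ', hr⟩ := chain_reverse f hf hrec δ hδ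
    have hba : ExistsDeltaChain f δ b a := (chain_iff _ _ _ _).2
      ((hr _ _ ((hmem _ _).1 hb δ' hδ')).trans ((hmem _ _).1 (hA ha) δ hδ))
    obtain ⟨n, hn, x, h0, hxn, hx⟩ := hba
    obtain ⟨z, hz⟩ := hs (fun i => if i < n then x i else f^[i - n] a) (by
      intro i
      rcases lt_trichotomy (i + 1) n with h | h | h
      · have h1 : i < n := by omega
        simpa [h, h1] using hx i h1
      · have h1 : i < n := by omega
        have h2 := hx i h1
        rw [h, hxn] at h2
        simpa [h, h1] using h2
      · have h1 : ¬ i < n := by omega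
        have h2 : ¬ i + 1 < n := by omega
        have h3 : i + 1 - n = (i - n) + 1 := by omega
        simp only [h1, h2, if_false, h3, Function.iterate_succ_apply', dist_self]
        exact hδ)
    obtain ⟨m, hm, hd⟩ := recurrent_large f hf z (hrec z) n (ε / 3) (by linarith)
    refine ⟨f^[m - n] a, horb _, ?_⟩
    have e0 := hz 0
    have em := hz m
    simp only [hn, if_true, h0, Function.iterate_zero, id] at e0
    simp only [not_lt.2 hm, if_false] at em
    rw [dist_comm] at e0 hd
    linarith [dist_triangle4 b z (f^[m] z) (f^[m - n] a)]
end

section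
/- Let X be an infinite rigid compact metric space and let f : X → X be a continuous surjection. Then the system (X,f) does not have shadowing. -/
/-- The system `(X, f)` is uniformly rigid. -/
def UniformlyRigid {X : Type*} [MetricSpace X] (f : X → X) : Prop :=
  ∀ ε > (0 : ℝ), ∃ n : ℕ, 0 < n ∧ ∀ x : X, dist (f^[n] x) x < ε

/-- A compact metric space `X` is rigid if every continuous surjection of `X` is
uniformly rigid. -/
def RigidSpace (X : Type*) [MetricSpace X] : Prop :=
  ∀ f : X → X, Continuous f → Function.Surjective f → UniformlyRigid f

/-- A uniformly rigid map is injective. -/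
theorem UniformlyRigid.inj {X : Type*} [MetricSpace X] {f : X → X} (h : UniformlyRigid f) :
    Function.Injective f := by
  intro x y hxy
  by_contra hne
  have hd : 0 < dist x y := dist_pos.2 hne
  obtain ⟨n, hn, H⟩ := h (dist x y / 2) (by linarith)
  obtain ⟨k, rfl⟩ := Nat.exists_eq_succ_of_ne_zero hn.ne'
  have h1 := H x
  have h2 := H y
  rw [Function.iterate_succ_apply] at h1 h2
  rw [hxy] at h1
  have := dist_triangle_left x y (f^[k] (f y))
  linarith

/-- Infinitely many isolated points give a non-injective continuous surjection. -/
theorem noninj_of_isolated {X : Type*} [MetricSpace X] [CompactSpace X]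
    (hS : {x : X | IsOpen ({x} : Set X)}.Infinite) :
    ∃ h : X → X, Continuous h ∧ Function.Surjective h ∧ ¬ Function.Injective h := by
  classical
  let e := hS.natEmbedding
  obtain ⟨p, φ, hφ, hp⟩ := CompactSpace.tendsto_subseq (fun n => (e n : X))
  set a : ℕ → X := fun n => (e (φ n) : X) with ha
  have hainj : Function.Injective a := fun m n hmn => by
    exact hφ.injective (e.injective (Subtype.ext hmn))
  have hlim : Filter.Tendsto a Filter.atTop (nhds p) := hp
  have hd : Filter.Tendsto (fun n => dist (a (n - 1)) (a n)) Filter.atTop (nhds 0) := by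
    have := (hlim.comp (Filter.tendsto_sub_atTop_nat 1)).dist hlim
    simpa using this
  let h : X → X := Function.extend a (fun n => a (n - 1)) id
  have h_a : ∀ n, h (a n) = a (n - 1) := fun n => hainj.extend_apply _ _ n
  have h_n : ∀ x, (¬ ∃ n, a n = x) → h x = x := fun x hx => by
    simp only [h]; rw [Function.extend_apply' _ _ _ hx]; rfl
  refine ⟨h, ?_, ?_, ?_⟩
  · rw [continuous_iff_continuousAt]
    intro x
    by_cases hx : IsOpen ({x} : Set X)
    · rw [ContinuousAt, (isOpen_singleton_iff_nhds_eq_pure x).1 hx]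
      exact Filter.tendsto_pure_left.2 fun s hs => mem_of_mem_nhds hs
    · have hxa : ¬ ∃ n, a n = x := by
        rintro ⟨n, rfl⟩
        exact hx (e (φ n)).2
      rw [ContinuousAt, h_n x hxa]
      have hd0 : Filter.Tendsto (fun y => dist y (h y)) (nhds x) (nhds 0) := by
        rw [Metric.tendsto_nhds]
        intro ε hε
        obtain ⟨N, hN⟩ := Filter.eventually_atTop.1 ((Metric.tendsto_nhds.1 hd) ε hε)
        have hfin : (a '' Set.Iio N).Finite := (Set.finite_Iio N).image a
        have hmem : (a '' Set.Iio N)ᶜ ∈ nhds x := by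
          apply hfin.isClosed.isOpen_compl.mem_nhds
          rintro ⟨n, _, hn⟩
          exact hxa ⟨n, hn⟩
        filter_upwards [hmem] with y hy
        by_cases hya : ∃ n, a n = y
        · obtain ⟨n, rfl⟩ := hya
          have hn : N ≤ n := by
            by_contra hlt
            exact hy ⟨n, by simpa using hlt, rfl⟩
          have := hN n hn
          rw [h_a, dist_comm (a n)]
          exact this
        · rw [h_n y hya]; simpa using hε
      exact (tendsto_iff_of_dist hd0).1 Filter.tendsto_id
  · intro y
    by_cases hya : ∃ n, a n = y
    · obtain ⟨n, rfl⟩ := hya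
      exact ⟨a (n + 1), by rw [h_a]; simp⟩
    · exact ⟨y, h_n y hya⟩
  · intro hi
    have : a 0 = a 1 := hi (by rw [h_a, h_a])
    exact absurd (hainj this) (by norm_num)

/-- An infinite countable compact metric space has infinitely many isolated points. -/
theorem isolated_of_countable {X : Type*} [MetricSpace X] [CompactSpace X] [Infinite X]
    [Countable X] : {x : X | IsOpen ({x} : Set X)}.Infinite := by
  intro hfin
  have hd := dense_iUnion_interior_of_closed (f := fun x : X => ({x} : Set X))
    (fun x => isClosed_singleton) (by ext; simp)
  have hsub : (⋃ x : X, interior ({x} : Set X)) ⊆ {x : X | IsOpen ({x} : Set X)} := by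
    intro y hy
    obtain ⟨x, hx⟩ := Set.mem_iUnion.1 hy
    have hyx : y = x := by simpa using interior_subset hx
    subst hyx
    have : interior ({y} : Set X) = {y} :=
      subset_antisymm interior_subset (by simpa using hx)
    exact interior_eq_iff_isOpen.1 this
  have h1 := (hd.mono hsub).closure_eq
  rw [hfin.isClosed.closure_eq] at h1
  rw [h1] at hfin
  exact Set.infinite_univ hfin

/-- An uncountable totally disconnected compact metric space has a non-injective continuous
surjection. -/
theorem noninj_of_uncountable {X : Type*} [MetricSpace X] [CompactSpace X] [Nonempty X]
    [TotallyDisconnectedSpace X] (hX : ¬ Countable X) :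
    ∃ h : X → X, Continuous h ∧ Function.Surjective h ∧ ¬ Function.Injective h := by
  classical
  obtain ⟨i, -, hic, hii⟩ := isClosed_univ.exists_nat_bool_injection_of_not_countable (α := X)
    (by rwa [Set.countable_univ_iff])
  obtain ⟨s, hsc, hss⟩ := exists_nat_bool_continuous_surjective_of_compact X
  have : Countable (TopologicalSpace.Clopens X) :=
    TopologicalSpace.Clopens.countable_iff_secondCountable.2 inferInstance
  obtain ⟨U, hU⟩ := exists_surjective_nat (TopologicalSpace.Clopens X)
  let j : X → (ℕ → Bool) := fun x n => (U n : Set X).boolIndicator x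
  have hjc : Continuous j := continuous_pi fun n =>
    (continuous_boolIndicator_iff_isClopen _).2 (U n).isClopen
  have hji : Function.Injective j := by
    intro x y hxy
    by_contra hne
    obtain ⟨V, hV, hxV, hyV⟩ := exists_isClopen_of_totally_separated hne
    obtain ⟨n, hn⟩ := hU ⟨V, hV⟩
    have h1 := congrFun hxy n
    simp only [j, hn] at h1
    have h2 := (Set.mem_iff_boolIndicator V x).1 hxV
    have h3 := (Set.notMem_iff_boolIndicator V y).1 hyV
    simp only [TopologicalSpace.Clopens.coe_mk] at h1
    rw [h2, h3] at h1
    exact absurd h1 (by simp)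
  have hk : Topology.IsClosedEmbedding (j ∘ i) :=
    (hjc.comp hic).isClosedEmbedding (hji.comp hii)
  obtain ⟨r, hr, hrr, hrc⟩ := PiNat.exists_retraction_of_isClosed hk.isClosed_range
    (Set.range_nonempty _)
  let g := hk.isEmbedding.toHomeomorph
  let r' : (ℕ → Bool) → Set.range (j ∘ i) := fun z => ⟨r z, hrr ▸ Set.mem_range_self z⟩
  have hr'c : Continuous r' := hrc.subtype_mk _
  let t : X → (ℕ → Bool) := fun x => g.symm (r' (j x))
  have htc : Continuous t := g.symm.continuous.comp (hr'c.comp hjc)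
  have hts : ∀ z, t (i z) = z := by
    intro z
    apply g.injective
    simp only [t, Homeomorph.apply_symm_apply]
    apply Subtype.ext
    exact hr _ (Set.mem_range_self z)
  let σ : (ℕ → Bool) → (ℕ → Bool) := fun z n => z (n + 1)
  have hσ : Continuous σ := continuous_pi fun n => continuous_apply (n + 1)
  refine ⟨s ∘ σ ∘ t, hsc.comp (hσ.comp htc), ?_, ?_⟩
  · intro y
    obtain ⟨z, rfl⟩ := hss y
    refine ⟨i (fun n => Nat.casesOn n true z), ?_⟩
    simp only [Function.comp, hts]
    rfl
  · intro hinj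
    let u : Bool → ℕ → Bool := fun b n => Nat.casesOn n b (fun _ => true)
    have : i (u true) = i (u false) := by
      apply hinj
      simp only [Function.comp, hts]
      rfl
    have := congrFun (hii this) 0
    exact absurd this (by simp [u])

/-- Chains as eventually constant sequences. -/
theorem chain_seq {X : Type*} [MetricSpace X] {η : ℝ} (hη : 0 < η) {x y : X}
    (h : Relation.ReflTransGen (fun a b => dist a b < η) x y) :
    ∃ (c : ℕ → X) (m : ℕ), c 0 = x ∧ (∀ k, m ≤ k → c k = y) ∧
      ∀ k, dist (c k) (c (k + 1)) < η := by
  induction h using Relation.ReflTransGen.head_induction_on with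
  | refl => exact ⟨fun _ => y, 0, rfl, fun _ _ => rfl, fun _ => by simpa using hη⟩
  | @head a b hab _ ih =>
    obtain ⟨c, m, h0, hm, hc⟩ := ih
    refine ⟨fun n => Nat.casesOn n a c, m + 1, rfl, ?_, ?_⟩
    · intro k hk
      obtain ⟨l, rfl⟩ : ∃ l, k = l + 1 := ⟨k - 1, by omega⟩
      exact hm l (by omega)
    · intro k
      cases k with
      | zero => simpa [h0] using hab
      | succ l => exact hc l

theorem iterate_close {X : Type*} [MetricSpace X] {g : X → X} {η : ℝ}
    (h : ∀ x, dist (g x) x ≤ η) (k : ℕ) (x : X) : dist (g^[k] x) x ≤ k * η := by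
  induction k with
  | zero => simp
  | succ k ih =>
    rw [Function.iterate_succ_apply']
    have := dist_triangle (g (g^[k] x)) (g^[k] x) x
    have := h (g^[k] x)
    push_cast
    linarith

/-- A uniformly rigid system with shadowing lives on a totally separated space. -/
theorem separated_of_shadowing {X : Type*} [MetricSpace X] {f : X → X}
    (hr : UniformlyRigid f) (hs : HasShadowing f) : TotallySeparatedSpace X := by
  rw [totallySeparatedSpace_iff_exists_isClopen]
  intro x y hxy
  have hd : 0 < dist x y := dist_pos.2 hxy
  set ε := dist x y / 3 with hε
  have hε0 : 0 < ε := by positivity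
  obtain ⟨δ, hδ, hsh⟩ := hs ε hε0
  obtain ⟨n, hn, hfn⟩ := hr (δ / 2) (by linarith)
  let R : X → X → Prop := fun a b => dist a b < δ / 2
  refine ⟨{z | Relation.ReflTransGen R x z}, ⟨?_, ?_⟩, Relation.ReflTransGen.refl, ?_⟩
  · rw [← isOpen_compl_iff, Metric.isOpen_iff]
    intro z hz
    refine ⟨δ / 2, by linarith, fun w hw hw' => hz ?_⟩
    exact Relation.ReflTransGen.tail hw' hw
  · rw [Metric.isOpen_iff]
    intro z hz
    refine ⟨δ / 2, by linarith, fun w hw => ?_⟩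
    exact Relation.ReflTransGen.tail hz (by simpa [R, dist_comm] using hw)
  · intro hchain
    obtain ⟨c, m, h0, hm, hc⟩ := chain_seq (by linarith) hchain
    obtain ⟨z, hz⟩ := hsh (fun i => f^[i % n] (c (i / n))) (by
      intro i
      rw [← Function.iterate_succ_apply' f]
      by_cases hi : i % n + 1 = n
      · have hi2 : i + 1 = n * (i / n + 1) := by
          rw [mul_add]; have := Nat.div_add_mod i n; omega
        have h1 : (i + 1) % n = 0 := by
          rw [hi2]; simp
        have h2 : (i + 1) / n = i / n + 1 := by
          rw [hi2]; simp [hn]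
        rw [h1, h2, Nat.succ_eq_add_one, hi, Function.iterate_zero, id]
        have := dist_triangle (f^[n] (c (i / n))) (c (i / n)) (c (i / n + 1))
        have := hfn (c (i / n))
        have := hc (i / n)
        linarith
      · have hlt := Nat.mod_lt i hn
        have hi2 : i + 1 = (i % n + 1) + n * (i / n) := by
          have := Nat.div_add_mod i n; omega
        have h1 : (i + 1) % n = i % n + 1 := by
          conv_lhs => rw [hi2]
          rw [Nat.add_mul_mod_self_left, Nat.mod_eq_of_lt (by omega)]
        have h2 : (i + 1) / n = i / n := by
          conv_lhs => rw [hi2]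
          rw [Nat.add_mul_div_left _ _ hn, Nat.div_eq_of_lt (by omega), zero_add]
        rw [h1, h2]
        simpa using hδ)
    obtain ⟨N, hN, hfN⟩ := hr (ε / (n * (m + 1) : ℕ)) (by positivity)
    have e1 : dist z x < ε := by simpa [h0] using hz 0
    have e2 : dist (f^[N * (n * (m + 1))] z) y < ε := by
      have := hz (N * (n * (m + 1)))
      have q1 : N * (n * (m + 1)) % n = 0 := by
        rw [show N * (n * (m + 1)) = n * (N * (m + 1)) by ring]; simp
      have q2 : N * (n * (m + 1)) / n = N * (m + 1) := by
        rw [show N * (n * (m + 1)) = n * (N * (m + 1)) by ring]; simp [hn]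
      simp only [q1, q2, Function.iterate_zero, id] at this
      rwa [hm _ (by nlinarith)] at this
    have e3 : dist (f^[N * (n * (m + 1))] z) z ≤ ε := by
      rw [Function.iterate_mul]
      have := iterate_close (fun x => (hfN x).le) (n * (m + 1)) z
      rwa [mul_div_cancel₀] at this
      positivity
    have t1 := dist_triangle x z y
    have t2 := dist_triangle_left z y (f^[N * (n * (m + 1))] z)
    rw [dist_comm x z] at t1
    linarith

/-- If `X` is an infinite rigid compact metric space and `f : X → X` is a continuous
surjection, then `(X, f)` does not have shadowing. -/
theorem infinite_rigid_no_shadowing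
    {X : Type*} [MetricSpace X] [CompactSpace X] [Infinite X]
    (hrig : RigidSpace X)
    (f : X → X) (hf : Continuous f) (hsurj : Function.Surjective f) :
    ¬ HasShadowing f := by
  intro hs
  have := separated_of_shadowing (hrig f hf hsurj) hs
  obtain ⟨h, hc, hsu, hni⟩ : ∃ h : X → X,
      Continuous h ∧ Function.Surjective h ∧ ¬ Function.Injective h := by
    by_cases hX : Countable X
    · exact noninj_of_isolated isolated_of_countable
    · exact noninj_of_uncountable hX
  exact hni (hrig h hc hsu).inj
end
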